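/- arXiv:math/0502123 — 2 statements merged into one kernel-verified Lean document; each statement's English description precedes it below -/
import Mathlib

section
/- Let k be an algebraically closed field and p an odd prime with p ≠ char(k). Let G be a subgroup of Aut_k(k(x,y)) such that every element of G maps the subfield k(x) onto itself, and suppose G is isomorphic to (ℤ/p)². Then there exists φ ∈ Aut_k(k(x,y)) with φ(k(x)) = k(x) such that φ G φ⁻¹ is the subgroup of all automorphisms determined by x ↦ βx, y ↦ αy with α, β ∈ k, α^p = β^p = 1. -/
/-- The field `k(x,y)` of rational functions in two variables over `k`. -/
noncomputable abbrev Kxy (k : Type*) [Field k] : Type _ :=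
  FractionRing (MvPolynomial (Fin 2) k)

/-- The images of the variables `x = X 0` and `y = X 1` in `k(x,y)`. -/
noncomputable abbrev Xv (k : Type*) [Field k] (i : Fin 2) : Kxy k :=
  algebraMap (MvPolynomial (Fin 2) k) (Kxy k) (MvPolynomial.X i)

/-- The subfield `k(x) ⊆ k(x,y)`. -/
noncomputable abbrev Kx (k : Type*) [Field k] : IntermediateField k (Kxy k) :=
  IntermediateField.adjoin k {Xv k 0}

section

open IntermediateField Polynomial

/-- If `T ^ p = 1` and the ground field contains a primitive `p`-th root of unity, then the
eigenvectors of `T` in a stable subspace `S` span `S`. -/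
theorem exists_eigenvector_mem_notMem {F V : Type*} [Field F] [AddCommGroup V] [Module F V]
    {p : ℕ} [NeZero p] {ζ : F} (hζ : IsPrimitiveRoot ζ p) (T : V →ₗ[F] V) (S W : Submodule F V)
    (hS : ∀ x ∈ S, T x ∈ S) (hT : ∀ x ∈ S, (T ^ p) x = x) {v : V} (hv : v ∈ S) (hvW : v ∉ W) :
    ∃ (j : ℕ) (x : V), x ∈ S ∧ x ∉ W ∧ T x = ζ ^ j • x := by
  have hp0 : (p : F) ≠ 0 := (hζ.neZero').out
  have hζ0 : ζ ≠ 0 := hζ.ne_zero (NeZero.ne p)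
  have hpow : ∀ i, (T ^ i) v ∈ S := fun i ↦ by
    induction i with
    | zero => simpa
    | succ i ih => rw [pow_succ']; exact hS _ ih
  let e : ℕ → V := fun j ↦ ∑ i ∈ Finset.range p, (ζ⁻¹ ^ j) ^ i • (T ^ i) v
  have he : ∀ j, T (e j) = ζ ^ j • e j := by
    intro j
    have h1 : ζ⁻¹ ^ j * ζ ^ j = 1 := by rw [← mul_pow, inv_mul_cancel₀ hζ0, one_pow]
    have h2 : (ζ⁻¹ ^ j) ^ p = 1 := by
      rw [pow_right_comm, inv_pow, hζ.pow_eq_one]; simp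
    have key : ∑ i ∈ Finset.range p, (ζ⁻¹ ^ j) ^ (i + 1) • (T ^ (i + 1)) v = e j := by
      have := Finset.sum_range_succ' (fun i ↦ (ζ⁻¹ ^ j) ^ i • (T ^ i) v) p
      rw [Finset.sum_range_succ, h2, hT v hv] at this
      simpa [e] using this.symm
    conv_rhs => rw [← key]
    simp only [e, map_sum, Finset.smul_sum]
    refine Finset.sum_congr rfl fun i _ ↦ ?_
    rw [map_smul, smul_smul, pow_succ, mul_left_comm, mul_comm (ζ ^ j), h1, mul_one, pow_succ' T,
      Module.End.mul_apply]
  have hsum : ∑ j ∈ Finset.range p, e j = (p : F) • v := by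
    have hζ' := hζ.inv
    simp only [e]
    rw [Finset.sum_comm]
    simp_rw [← Finset.sum_smul, pow_right_comm _ _ _]
    rw [Finset.sum_eq_single 0]
    · simp
    · intro i hi hi0
      have hne : ζ⁻¹ ^ i ≠ 1 := hζ'.pow_ne_one_of_pos_of_lt hi0 (Finset.mem_range.1 hi)
      have : ∑ j ∈ Finset.range p, (ζ⁻¹ ^ i) ^ j = 0 := by
        rw [geom_sum_eq hne, pow_right_comm, hζ'.pow_eq_one]; simp
      rw [this, zero_smul]
    · simp [NeZero.ne p]
  by_contra! hcon
  refine hvW ((W.smul_mem_iff hp0).1 (hsum ▸ W.sum_mem fun j _ ↦ ?_))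
  by_contra hj
  exact hcon j (e j) (S.sum_mem fun i _ ↦ S.smul_mem _ (hpow i)) hj (he j)

theorem Transcendental.eq_zero_of_quadratic {F E : Type*} [Field F] [Field E] [Algebra F E]
    {u : E} (hu : Transcendental F u) {a b c : F}
    (h : algebraMap F E a * u ^ 2 + algebraMap F E b * u + algebraMap F E c = 0) :
    a = 0 ∧ b = 0 ∧ c = 0 := by
  have := (transcendental_iff.1 hu) (C a * X ^ 2 + C b * X + C c) (by simpa using h)
  refine ⟨by simpa using congr(($this).coeff 2), by simpa using congr(($this).coeff 1),
    by simpa using congr(($this).coeff 0)⟩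

/-- Two generators of a purely transcendental simple extension differ by a Möbius
transformation. -/
theorem Transcendental.exists_moebius {F E : Type*} [Field F] [Field E] [Algebra F E]
    {u w : E} (hu : Transcendental F u) (h : F⟮w⟯ = F⟮u⟯) :
    ∃ a b c d : F, algebraMap F E c * u + algebraMap F E d ≠ 0 ∧
      w * (algebraMap F E c * u + algebraMap F E d) =
        algebraMap F E a * u + algebraMap F E b := by
  let ι : RatFunc F →ₐ[F] E := (F⟮u⟯.val).comp (RatFunc.algEquivOfTranscendental u hu).toAlgHom
  have hιX : ι RatFunc.X = u := by simp [ι]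
  have hι : ∀ P : F[X], ι (algebraMap F[X] (RatFunc F) P) = Polynomial.aeval u P := fun P ↦ by
    simp [ι]
  have hrange : ι.fieldRange = F⟮u⟯ := by
    rw [AlgHom.fieldRange_eq_map, ← RatFunc.adjoin_X, adjoin_map, Set.image_singleton, hιX]
  obtain ⟨f, hf⟩ : w ∈ ι.fieldRange := by
    rw [hrange, ← h]; exact mem_adjoin_simple_self F w
  change ι f = w at hf
  have htop : F⟮f⟯ = ⊤ := by
    apply IntermediateField.map_injective ι
    rw [adjoin_map, Set.image_singleton, hf, h, ← hrange, AlgHom.fieldRange_eq_map]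
  have hrank := f.finrank_eq_max_natDegree
  rw [htop, IntermediateField.finrank_top] at hrank
  have hn : f.num.natDegree ≤ 1 := hrank ▸ le_max_left _ _
  have hd : f.denom.natDegree ≤ 1 := hrank ▸ le_max_right _ _
  obtain ⟨a, b, hab⟩ := exists_eq_X_add_C_of_natDegree_le_one hn
  obtain ⟨c, d, hcd⟩ := exists_eq_X_add_C_of_natDegree_le_one hd
  have hD : ι (algebraMap F[X] (RatFunc F) f.denom) =
      algebraMap F E c * u + algebraMap F E d := by
    rw [hι, hcd]; simp
  have hN : ι (algebraMap F[X] (RatFunc F) f.num) =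
      algebraMap F E a * u + algebraMap F E b := by
    rw [hι, hab]; simp
  have hne : algebraMap F[X] (RatFunc F) f.denom ≠ 0 := RatFunc.algebraMap_ne_zero f.denom_ne_zero
  refine ⟨a, b, c, d, ?_, ?_⟩
  · rw [← hD]; simpa using hne
  · rw [← hD, ← hN, ← hf, ← map_mul]
    congr 1
    rw [← eq_div_iff hne, RatFunc.num_div_denom]

/-- A generator which scales in the same way as `u` under an automorphism of order greater
than two is a multiple of `u`. -/
theorem Transcendental.exists_eq_mul_of_scaling {F E : Type*} [Field F] [Field E] [Algebra F E]
    {u w : E} (hu : Transcendental F u) (h : F⟮w⟯ = F⟮u⟯) {s : E →+* E}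
    (hs : ∀ a : F, s (algebraMap F E a) = algebraMap F E a) {z : F} (hz0 : z ≠ 0)
    (hz2 : z ^ 2 ≠ 1)
    (hsu : s u = algebraMap F E z * u) (hsw : s w = algebraMap F E z * w) :
    ∃ f : F, w = algebraMap F E f * u := by
  obtain ⟨a, b, c, d, hD, hw⟩ := hu.exists_moebius h
  have hz1 : z ≠ 1 := by rintro rfl; simp at hz2
  have h1 := congr(s $hw)
  simp only [map_mul, map_add, hs, hsu, hsw] at h1
  have h2 : algebraMap F E (a * c * z * (1 - z)) * u ^ 2 +
      algebraMap F E (b * c * (1 - z ^ 2)) * u + algebraMap F E (b * d * (1 - z)) = 0 := by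
    simp only [map_mul, map_sub, map_one, map_pow]
    linear_combination -(algebraMap F E c * u + algebraMap F E d) * h1 + algebraMap F E z *
      (algebraMap F E c * (algebraMap F E z * u) + algebraMap F E d) * hw
  obtain ⟨hac, hbc, hbd⟩ := hu.eq_zero_of_quadratic h2
  have hac' : a = 0 ∨ c = 0 := by
    simpa [hz0, sub_eq_zero, hz1.symm] using hac
  have hbd' : b = 0 ∨ d = 0 := by
    simpa [sub_eq_zero, hz1.symm] using hbd
  have hbc' : b = 0 ∨ c = 0 := by
    simpa [sub_eq_zero, hz2.symm] using hbc
  by_cases hb : b = 0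
  · subst hb
    rcases hac' with rfl | rfl
    · exact ⟨0, by simpa [hD] using hw⟩
    · have hd : algebraMap F E d ≠ 0 := by simpa using hD
      refine ⟨a / d, ?_⟩
      rw [map_div₀]
      field_simp
      simpa [mul_comm] using hw
  · simp [hbd'.resolve_left hb, hbc'.resolve_left hb] at hD

/-- The affine form `r 0 * u + r 1` with coefficients `r`. -/
noncomputable def affineForm (F : Type*) {E : Type*} [Field F] [Field E] [Algebra F E] (u : E) :
    (Fin 2 → F) →ₗ[F] E :=
  Fintype.linearCombination F ![u, 1]

theorem affineForm_apply {F E : Type*} [Field F] [Field E] [Algebra F E] (u : E) (r : Fin 2 → F) :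
    affineForm F u r = algebraMap F E (r 0) * u + algebraMap F E (r 1) := by
  simp [affineForm, Fintype.linearCombination_apply, Fin.sum_univ_two, Algebra.smul_def]

theorem Transcendental.affineForm_injective {F E : Type*} [Field F] [Field E] [Algebra F E] {u : E}
    (hu : Transcendental F u) : Function.Injective (affineForm F u) := by
  rw [injective_iff_map_eq_zero]
  intro r hr
  rw [affineForm_apply] at hr
  obtain ⟨-, h0, h1⟩ := hu.eq_zero_of_quadratic (a := 0) (b := r 0) (c := r 1) (by simpa using hr)
  ext i
  fin_cases i
  exacts [h0, h1]

/-- An automorphism of odd prime order `p` of the projective line lifts to a linear automorphism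
`T` with `T ^ p = 1`, where `affineForm F u` identifies linear forms with elements of `F(u)`. -/
theorem Transcendental.exists_linear_lift {F E : Type*} [Field F] [Field E] [Algebra F E]
    {u : E} (hu : Transcendental F u) {p : ℕ} (hodd : Odd p)
    {s : E →+* E} (hs : ∀ a : F, s (algebraMap F E a) = algebraMap F E a)
    (hgen : F⟮s u⟯ = F⟮u⟯) (hsp : (s ^ p) u = u) :
    ∃ (T : Module.End F (Fin 2 → F)) (D : E), D ≠ 0 ∧ T ^ p = 1 ∧
      ∀ r, s (affineForm F u r) * D = affineForm F u (T r) := by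
  obtain ⟨a, b, c, d, hD, hw⟩ := hu.exists_moebius hgen
  let T : Module.End F (Fin 2 → F) := Matrix.vecMulLinear !![a, b; c, d]
  set D := algebraMap F E c * u + algebraMap F E d with hDdef
  have hT : ∀ r, s (affineForm F u r) * D = affineForm F u (T r) := fun r ↦ by
    simp only [affineForm_apply, T, map_add, map_mul, hs, Matrix.coe_vecMulLinear,
      Matrix.vecMul_eq_sum, Fin.sum_univ_two]
    simp
    linear_combination algebraMap F E (r 0) * hw
  have hiter : ∀ n, ∃ D' : E, D' ≠ 0 ∧
      ∀ r, (s ^ n) (affineForm F u r) * D' = affineForm F u ((T ^ n) r) := fun n ↦ by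
    induction n with
    | zero => exact ⟨1, one_ne_zero, fun r ↦ by simp⟩
    | succ n ih =>
      obtain ⟨D', hD', h⟩ := ih
      refine ⟨s D' * D, mul_ne_zero (by simpa using hD') hD, fun r ↦ ?_⟩
      rw [pow_succ' T, Module.End.mul_apply, ← hT, ← h, map_mul, pow_succ' s]
      simp [mul_assoc]
  have hsF : ∀ n, ∀ x : F, (s ^ n) (algebraMap F E x) = algebraMap F E x := fun n x ↦ by
    induction n with
    | zero => simp
    | succ n ih => rw [pow_succ, RingHom.mul_def, RingHom.comp_apply, hs, ih]
  obtain ⟨D', hD', h⟩ := hiter p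
  have hfix : ∀ r, affineForm F u r * D' = affineForm F u ((T ^ p) r) := fun r ↦ by
    rw [← h]
    congr 1
    simp only [affineForm_apply, map_add, map_mul, hsF, hsp]
  obtain ⟨α, hα⟩ : ∃ α : F, D' = algebraMap F E α := by
    have h0 := hfix ![1, 0]
    have h1 := hfix ![0, 1]
    set r := (T ^ p) ![1, 0]
    set r' := (T ^ p) ![0, 1]
    simp [affineForm_apply] at h0 h1
    obtain ⟨h2, -, -⟩ := hu.eq_zero_of_quadratic (a := r' 0) (b := r' 1 - r 0) (c := - r 1)
      (by simp only [map_sub, map_neg]; linear_combination h0 - u * h1)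
    exact ⟨r' 1, by simpa [h2] using h1⟩
  have hα0 : α ≠ 0 := by rintro rfl; simp [hα] at hD'
  have hTp : T ^ p = α • 1 := by
    refine LinearMap.ext fun r ↦ hu.affineForm_injective ?_
    rw [← hfix, hα, LinearMap.smul_apply, map_smul, Algebra.smul_def, mul_comm,
      Module.End.one_apply]
  have hdet : LinearMap.det T ^ p = α ^ 2 := by
    rw [← map_pow, hTp, LinearMap.det_smul]; simp
  have hdet0 : LinearMap.det T ≠ 0 := by
    intro h0
    rw [h0, zero_pow hodd.pos.ne'] at hdet
    exact pow_ne_zero 2 hα0 hdet.symm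
  obtain ⟨m, rfl⟩ := hodd
  let δ := α / LinearMap.det T ^ m
  have hδ0 : δ ≠ 0 := div_ne_zero hα0 (pow_ne_zero _ hdet0)
  have hδ : δ ^ (2 * m + 1) = α := by
    have : (LinearMap.det T ^ m) ^ (2 * m + 1) = α ^ (2 * m) := by
      rw [pow_right_comm, hdet, pow_mul]
    rw [div_pow, this, pow_succ', mul_div_cancel_right₀ _ (pow_ne_zero _ hα0)]
  refine ⟨δ⁻¹ • T, algebraMap F E δ⁻¹ * D, mul_ne_zero (by simpa using hδ0) hD, ?_, fun r ↦ ?_⟩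
  · rw [_root_.smul_pow, hTp, inv_pow, hδ, smul_smul, inv_mul_cancel₀ hα0, one_smul]
  · rw [LinearMap.smul_apply, map_smul, ← hT, Algebra.smul_def]
    ring

/-- An automorphism of odd prime order of the projective line over a field with a primitive
`p`-th root of unity can be diagonalised. -/
theorem Transcendental.exists_scaled_generator {F E : Type*} [Field F] [Field E] [Algebra F E]
    {u : E} (hu : Transcendental F u) {p : ℕ} (hodd : Odd p)
    {ζ : F} (hζ : IsPrimitiveRoot ζ p)
    {s : E →+* E} (hs : ∀ a : F, s (algebraMap F E a) = algebraMap F E a)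
    (hgen : F⟮s u⟯ = F⟮u⟯) (hsp : (s ^ p) u = u) (hsu : s u ≠ u) :
    ∃ (v : E) (j : ℕ), F⟮v⟯ = F⟮u⟯ ∧ ζ ^ j ≠ 1 ∧ s v = algebraMap F E (ζ ^ j) * v := by
  have : NeZero p := ⟨hodd.pos.ne'⟩
  have hζ0 : ζ ≠ 0 := hζ.ne_zero (NeZero.ne p)
  obtain ⟨T, D, hD, hTp, hT⟩ := hu.exists_linear_lift hodd hs hgen hsp
  have hinj := hu.affineForm_injective
  obtain ⟨i, v, -, hv0, hv⟩ := exists_eigenvector_mem_notMem hζ T ⊤ ⊥ (by simp) (by simp [hTp])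
    (v := 1) trivial (by simp)
  obtain ⟨r, hr⟩ : ∃ r, r ∉ Module.End.eigenspace T (ζ ^ i) := by
    by_contra! hcon
    simp only [Module.End.mem_eigenspace_iff] at hcon
    have h0 := hT ![1, 0]
    have h1 := hT ![0, 1]
    rw [hcon] at h0 h1
    simp [affineForm_apply, -map_pow] at h0 h1
    rw [← h1, mul_comm] at h0
    exact hsu (mul_left_cancel₀ hD h0)
  obtain ⟨j, w, -, hwW, hw⟩ :=
    exists_eigenvector_mem_notMem hζ T ⊤ (Module.End.eigenspace T (ζ ^ i))
    (by simp) (by simp [hTp]) (v := r) trivial hr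
  rw [Module.End.mem_eigenspace_iff, hw] at hwW
  have hw0 : w ≠ 0 := by rintro rfl; simp at hwW
  have hij : ζ ^ j ≠ ζ ^ i := fun h ↦ hwW (by rw [h])
  rw [Submodule.mem_bot] at hv0
  have hlv : affineForm F u v ≠ 0 := by rwa [Ne, map_eq_zero_iff _ hinj]
  have hlw : affineForm F u w ≠ 0 := by rwa [Ne, map_eq_zero_iff _ hinj]
  have h1 := hT v
  have h2 := hT w
  rw [hv, map_smul, Algebra.smul_def] at h1
  rw [hw, map_smul, Algebra.smul_def] at h2
  set V := affineForm F u v with hV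
  set W := affineForm F u w with hW
  have hscale : s (W / V) * algebraMap F E (ζ ^ i) = algebraMap F E (ζ ^ j) * (W / V) := by
    rw [map_div₀]
    have hsV : s V ≠ 0 := by simpa using hlv
    field_simp
    apply mul_right_cancel₀ hD
    linear_combination (algebraMap F E (ζ ^ i)) * V * h2 - (algebraMap F E (ζ ^ j)) * W * h1
  have hpow : ζ ^ (j + (p - 1) * i) * ζ ^ i = ζ ^ j := by
    rw [← pow_add, add_assoc, ← Nat.succ_mul, Nat.succ_eq_add_one, Nat.sub_add_cancel hodd.pos,
      pow_add, pow_mul, hζ.pow_eq_one, one_pow, mul_one]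
  have hne : ζ ^ (j + (p - 1) * i) ≠ 1 := fun h ↦ hij (by rw [← hpow, h, one_mul])
  have hsc : s (W / V) = algebraMap F E (ζ ^ (j + (p - 1) * i)) * (W / V) := by
    have : algebraMap F E (ζ ^ i) ≠ 0 := by simp [hζ0]
    apply mul_right_cancel₀ this
    rw [hscale, mul_right_comm, ← map_mul, hpow]
  refine ⟨W / V, j + (p - 1) * i, le_antisymm ?_ ?_, hne, hsc⟩
  · rw [adjoin_simple_le_iff]
    have hmem : ∀ r, affineForm F u r ∈ F⟮u⟯ := fun r ↦ by
      rw [affineForm_apply]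
      exact add_mem (mul_mem (_root_.algebraMap_mem _ _) (mem_adjoin_simple_self F u))
        (_root_.algebraMap_mem _ _)
    exact div_mem (hmem _) (hmem _)
  · rw [adjoin_simple_le_iff]
    set q := W / V with hq
    have hqV : q * V = W := div_mul_cancel₀ _ hlv
    have hqm : q ∈ F⟮q⟯ := mem_adjoin_simple_self F q
    have hq0 : q ≠ 0 := div_ne_zero hlw hlv
    rw [hV, hW, affineForm_apply, affineForm_apply] at hqV
    have hden : q * algebraMap F E (v 0) - algebraMap F E (w 0) ≠ 0 := by
      intro h0
      have hq' : ∃ f : F, q = algebraMap F E f := by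
        by_cases hv00 : v 0 = 0
        · have hv1 : v 1 ≠ 0 := fun h ↦ hv0 (by ext k; fin_cases k <;> simpa)
          refine ⟨w 1 / v 1, ?_⟩
          have : algebraMap F E (v 1) ≠ 0 := by simpa using hv1
          rw [map_div₀]
          field_simp
          linear_combination hqV - u * h0
        · refine ⟨w 0 / v 0, ?_⟩
          have : algebraMap F E (v 0) ≠ 0 := by simpa using hv00
          rw [map_div₀]
          field_simp
          linear_combination h0
      obtain ⟨f, hf⟩ := hq'
      have h3 : (1 : E) * q = algebraMap F E (ζ ^ (j + (p - 1) * i)) * q := by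
        rw [← hsc, hf, hs, one_mul]
      exact hne ((algebraMap F E).injective (by rw [← mul_right_cancel₀ hq0 h3, map_one]))
    have hu' : u = (algebraMap F E (w 1) - q * algebraMap F E (v 1)) /
        (q * algebraMap F E (v 0) - algebraMap F E (w 0)) := by
      rw [eq_div_iff hden]
      linear_combination hqV
    rw [hu']
    exact div_mem (sub_mem (_root_.algebraMap_mem _ _) (mul_mem hqm (_root_.algebraMap_mem _ _)))
      (sub_mem (mul_mem hqm (_root_.algebraMap_mem _ _)) (_root_.algebraMap_mem _ _))

theorem Transcendental.of_adjoin_eq {F E : Type*} [Field F] [Field E] [Algebra F E] {u w : E}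
    (hu : Transcendental F u) (h : F⟮w⟯ = F⟮u⟯) : Transcendental F w := by
  intro hw
  have : Algebra.IsAlgebraic F F⟮w⟯ := isAlgebraic_adjoin_simple hw.isIntegral
  have hmem : u ∈ F⟮w⟯ := h ▸ mem_adjoin_simple_self F u
  exact hu (isAlgebraic_iff.1 (Algebra.IsAlgebraic.isAlgebraic (R := F) (⟨u, hmem⟩ : F⟮w⟯)))

theorem IsPrimitiveRoot.of_prime {M : Type*} [CommMonoid M] {p : ℕ} (hp : p.Prime) {z : M}
    (h : z ^ p = 1) (h1 : z ≠ 1) : IsPrimitiveRoot z p := by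
  have := Fact.mk hp
  exact orderOf_eq_prime h h1 ▸ IsPrimitiveRoot.orderOf z

section

variable {k E : Type*} [Field k] [Field E] [Algebra k E]

theorem AlgEquiv.adjoin_simple_apply_eq {x : E} {g : E ≃ₐ[k] E}
    (hg : g '' (k⟮x⟯ : Set E) = k⟮x⟯) {v : E} (hv : k⟮v⟯ = k⟮x⟯) : k⟮g v⟯ = k⟮v⟯ := by
  have h : k⟮v⟯.map g.toAlgHom = k⟮g v⟯ := by
    rw [adjoin_map, Set.image_singleton]; rfl
  rw [← h, hv]
  exact SetLike.coe_injective hg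

theorem AlgEquiv.adjoin_apply_eq_top {K : IntermediateField k E} {g : E ≃ₐ[k] E}
    (hg : g '' (K : Set E) = K) {u : E} (hu : K⟮u⟯ = ⊤) : K⟮g u⟯ = ⊤ := by
  rw [← restrictScalars_eq_top_iff (K := k), restrictScalars_adjoin] at hu ⊢
  have := congrArg (IntermediateField.map g.toAlgHom) hu
  rw [adjoin_map, Set.image_union, Set.image_singleton] at this
  change adjoin k (g '' K ∪ {g u}) = _ at this
  rw [hg] at this
  rw [this, ← AlgHom.fieldRange_eq_map, AlgHom.fieldRange_eq_top]
  exact g.surjective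

theorem AlgEquiv.pow_apply_of_eq_mul {g : E ≃ₐ[k] E} {z f : E} (hz : g z = f * z)
    (hf : g f = f) (n : ℕ) : (g ^ n) z = f ^ n * z := by
  induction n with
  | zero => simp
  | succ n ih => rw [pow_succ', AlgEquiv.mul_apply, ih, map_mul, map_pow, hf, hz]; ring

theorem AlgEquiv.pow_eq_one_of_eq_mul {g : E ≃ₐ[k] E} {z f : E} (hz0 : z ≠ 0) (hz : g z = f * z)
    (hf : g f = f) {n : ℕ} (hn : g ^ n = 1) : f ^ n = 1 := by
  have := pow_apply_of_eq_mul hz hf n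
  rw [hn, AlgEquiv.one_apply] at this
  exact (mul_right_cancel₀ hz0 (by rw [one_mul]; exact this)).symm

theorem AlgEquiv.apply_eq_of_mem_adjoin {g h : E ≃ₐ[k] E} {S : Set E} (hS : ∀ a ∈ S, g a = h a)
    {a : E} (ha : a ∈ adjoin k S) : g a = h a := by
  induction ha using adjoin_induction with
  | mem a ha => exact hS a ha
  | algebraMap c => simp
  | add a b _ _ ha hb => simp [ha, hb]
  | inv a _ ha => simp [ha]
  | mul a b _ _ ha hb => simp [ha, hb]

theorem AlgEquiv.apply_eq_of_mem_adjoin_simple {g h : E ≃ₐ[k] E} {v : E} (hv : g v = h v) {a : E}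
    (ha : a ∈ k⟮v⟯) : g a = h a :=
  apply_eq_of_mem_adjoin (by simpa) ha

theorem AlgEquiv.eq_of_adjoin_eq_top {K : IntermediateField k E} {u : E} (hu : K⟮u⟯ = ⊤)
    {g h : E ≃ₐ[k] E} (hK : ∀ a ∈ K, g a = h a) (hgu : g u = h u) : g = h := by
  rw [← restrictScalars_eq_top_iff (K := k), restrictScalars_adjoin] at hu
  refine AlgEquiv.ext fun a ↦ apply_eq_of_mem_adjoin ?_ (hu ▸ mem_top : a ∈ adjoin k (K ∪ {u}))
  rintro a (ha | rfl)
  exacts [hK a ha, hgu]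

theorem AlgEquiv.toRingHom_pow_apply (g : E ≃ₐ[k] E) (n : ℕ) (a : E) :
    ((g : E →+* E) ^ n) a = (g ^ n) a := by
  induction n generalizing a with
  | zero => simp
  | succ n ih => rw [pow_succ, pow_succ, RingHom.mul_def, RingHom.comp_apply, ih]; rfl

/-- An automorphism `τ` of prime order scaling a generator of `k(x)` generates, modulo the
automorphisms which are trivial on `k(x)`, every commuting automorphism of order `p`. -/
theorem AlgEquiv.exists_scaled_base_generator {p : ℕ} (hp : p.Prime) (hodd : Odd p) {ζ : k}
    (hζ : IsPrimitiveRoot ζ p) {x : E} (hx : Transcendental k x) {τ : E ≃ₐ[k] E}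
    (hτ : τ '' (k⟮x⟯ : Set E) = k⟮x⟯) (hτp : τ ^ p = 1) (hτx : τ x ≠ x) :
    ∃ (v : E) (ζ' : k), k⟮v⟯ = k⟮x⟯ ∧ IsPrimitiveRoot ζ' p ∧ τ v = algebraMap k E ζ' * v ∧
      ∀ g : E ≃ₐ[k] E, g '' (k⟮x⟯ : Set E) = k⟮x⟯ → g ^ p = 1 → τ * g = g * τ →
        ∃ i : ℕ, ∀ a ∈ k⟮x⟯, g a = (τ ^ i) a := by
  obtain ⟨v, j, hv, hj, hτv⟩ := hx.exists_scaled_generator hodd hζ (s := (τ : E →+* E))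
    (by simp) (adjoin_simple_apply_eq hτ rfl) (by rw [toRingHom_pow_apply, hτp]; rfl) hτx
  have hζ' : IsPrimitiveRoot (ζ ^ j) p :=
    .of_prime hp (by rw [pow_right_comm, hζ.pow_eq_one, one_pow]) hj
  have hvt := hx.of_adjoin_eq hv
  have hv0 : v ≠ 0 := by rintro rfl; exact hvt isAlgebraic_zero
  refine ⟨v, ζ ^ j, hv, hζ', hτv, fun g hg hgp hcomm ↦ ?_⟩
  obtain ⟨f, hf⟩ := hvt.exists_eq_mul_of_scaling (adjoin_simple_apply_eq hg hv)
    (s := (τ : E →+* E)) (by simp) (hζ'.ne_zero hp.ne_zero)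
    (hζ'.pow_ne_one_of_pos_of_lt two_ne_zero
      (hp.two_le.lt_of_ne' (by rintro rfl; exact absurd hodd (by decide))))
    hτv (by
      change τ v = _ at hτv
      change (τ * g) v = _
      rw [hcomm, AlgEquiv.mul_apply, hτv, map_mul, commutes])
  have hfp : f ^ p = 1 := by
    have := pow_eq_one_of_eq_mul hv0 hf (by simp) hgp
    exact (algebraMap k E).injective (by simpa using this)
  have := NeZero.mk hp.ne_zero
  obtain ⟨i, -, hi⟩ := hζ'.eq_pow_of_pow_eq_one hfp
  refine ⟨i, fun a ha ↦ apply_eq_of_mem_adjoin_simple (v := v) ?_ (hv ▸ ha)⟩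
  rw [hf, pow_apply_of_eq_mul hτv (by simp), ← hi, map_pow (algebraMap k E)]

/-- A `K`-automorphism `σ` of prime order of `E = K(y)` scales some generator `u`, and every
commuting automorphism stabilising `K` multiplies `u` by an element of `K`. -/
theorem AlgEquiv.exists_scaled_fibre_generator {p : ℕ} (hp : p.Prime) (hodd : Odd p) {ζ : k}
    (hζ : IsPrimitiveRoot ζ p) {K : IntermediateField k E} {y : E} (hy : Transcendental K y)
    (hKy : K⟮y⟯ = ⊤) {σ : E ≃ₐ[k] E} (hσK : ∀ a ∈ K, σ a = a) (hσp : σ ^ p = 1) (hσ1 : σ ≠ 1) :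
    ∃ (u : E) (ζ' : k), K⟮u⟯ = ⊤ ∧ u ≠ 0 ∧ IsPrimitiveRoot ζ' p ∧ σ u = algebraMap k E ζ' * u ∧
      ∀ g : E ≃ₐ[k] E, g '' (K : Set E) = K → σ * g = g * σ → ∃ f ∈ K, g u = f * u := by
  have hζK : IsPrimitiveRoot (algebraMap k K ζ) p := hζ.map_of_injective (algebraMap k K).injective
  have hσK' : σ '' (K : Set E) = K := by
    rw [Set.image_congr hσK, Set.image_id']
  obtain ⟨u, j, hu, hj, hσu⟩ := hy.exists_scaled_generator hodd hζK (s := (σ : E →+* E))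
    (fun a ↦ hσK _ a.2) ((adjoin_apply_eq_top hσK' hKy).trans hKy.symm)
    (by rw [toRingHom_pow_apply, hσp]; rfl)
    (fun h ↦ hσ1 (eq_of_adjoin_eq_top hKy hσK h))
  have hjk : ζ ^ j ≠ 1 := fun h ↦ hj (by rw [← map_pow, h, map_one])
  have hut := hy.of_adjoin_eq hu
  have hζ' : IsPrimitiveRoot (ζ ^ j) p :=
    .of_prime hp (by rw [pow_right_comm, hζ.pow_eq_one, one_pow]) hjk
  have hζK' : IsPrimitiveRoot (algebraMap k K ζ ^ j) p :=
    .of_prime hp (by rw [pow_right_comm, hζK.pow_eq_one, one_pow]) hj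
  have hσu' : σ u = algebraMap k E (ζ ^ j) * u := by
    rw [← map_pow] at hσu; exact hσu
  refine ⟨u, ζ ^ j, hu.trans hKy, fun h ↦ hut (h ▸ isAlgebraic_zero), hζ', hσu',
    fun g hg hcomm ↦ ?_⟩
  obtain ⟨f, hf⟩ := hut.exists_eq_mul_of_scaling (w := g u)
    ((adjoin_apply_eq_top hg (hu.trans hKy)).trans (hu.trans hKy).symm)
    (s := (σ : E →+* E)) (fun a ↦ hσK _ a.2) (hζK'.ne_zero hp.ne_zero)
    (hζK'.pow_ne_one_of_pos_of_lt two_ne_zero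
      (hp.two_le.lt_of_ne' (by rintro rfl; exact absurd hodd (by decide))))
    hσu (by
      change (σ * g) u = _
      rw [hcomm, AlgEquiv.mul_apply, hσu', map_mul, commutes, ← map_pow]
      rfl)
  exact ⟨f, f.2, hf⟩

/-- Hilbert 90: a generator `u` multiplied by an element of `K` under `τ` may be rescaled to an
eigenvector of `τ`. -/
theorem AlgEquiv.exists_rescale {p : ℕ} (hp : p.Prime) {ζ : k} (hζ : IsPrimitiveRoot ζ p)
    {K : IntermediateField k E} {τ : E ≃ₐ[k] E} (hτK : τ '' (K : Set E) = K) (hτp : τ ^ p = 1)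
    {u : E} (hu0 : u ≠ 0) (hu : ∃ f ∈ K, τ u = f * u) :
    ∃ (h : E) (j : ℕ), h ∈ K ∧ h ≠ 0 ∧ τ (h * u) = algebraMap k E (ζ ^ j) * (h * u) := by
  have := NeZero.mk hp.ne_zero
  obtain ⟨f, hf, hτu⟩ := hu
  let S : Submodule k E := (Subalgebra.toSubmodule K.toSubalgebra).map (LinearMap.mulRight k u)
  have hS : ∀ a, a ∈ S ↔ ∃ b ∈ K, b * u = a := fun a ↦ by simp [S]
  have hpow : ∀ n a, (τ.toLinearMap ^ n) a = (τ ^ n) a := fun n a ↦ by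
    induction n generalizing a with
    | zero => simp
    | succ n ih => rw [pow_succ, pow_succ, Module.End.mul_apply, ih]; rfl
  obtain ⟨j, θ, hθ, hθ0, hτθ⟩ := exists_eigenvector_mem_notMem hζ τ.toLinearMap S ⊥
    (fun a ha ↦ by
      obtain ⟨b, hb, rfl⟩ := (hS a).1 ha
      have hτb : τ b ∈ K := by
        have := Set.mem_image_of_mem τ hb
        rwa [hτK] at this
      exact (hS _).2 ⟨τ b * f, mul_mem hτb hf, by simp [hτu, mul_assoc]⟩)
    (fun a _ ↦ by rw [hpow, hτp]; rfl) (v := u) ((hS u).2 ⟨1, one_mem K, one_mul u⟩) (by simpa)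
  obtain ⟨h, hh, rfl⟩ := (hS θ).1 hθ
  refine ⟨h, j, hh, left_ne_zero_of_mul (by simpa using hθ0), ?_⟩
  rw [← Algebra.smul_def]
  exact hτθ

/-- Simultaneous diagonalisation of a non-cyclic abelian group of exponent `p` acting on `k(x,y)`
and preserving `k(x)`. -/
theorem exists_simultaneous_diagonalisation {p : ℕ} (hp : p.Prime) (hodd : Odd p) {ζ : k}
    (hζ : IsPrimitiveRoot ζ p) {x y : E} (hx : Transcendental k x) (hy : Transcendental k⟮x⟯ y)
    (hxy : k⟮x⟯⟮y⟯ = ⊤) (G : Subgroup (E ≃ₐ[k] E))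
    (hGx : ∀ σ ∈ G, σ '' (k⟮x⟯ : Set E) = k⟮x⟯) (hcomm : ∀ σ ∈ G, ∀ τ ∈ G, σ * τ = τ * σ)
    (hexp : ∀ σ ∈ G, σ ^ p = 1) (hcyc : ∀ σ ∈ G, ¬ G ≤ Subgroup.zpowers σ) :
    ∃ (v θ : E) (σ τ : E ≃ₐ[k] E) (ζ₁ ζ₂ γ : k), k⟮v⟯ = k⟮x⟯ ∧ k⟮x⟯⟮θ⟯ = ⊤ ∧
      σ ∈ G ∧ τ ∈ G ∧ IsPrimitiveRoot ζ₁ p ∧ IsPrimitiveRoot ζ₂ p ∧ γ ^ p = 1 ∧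
      τ v = algebraMap k E ζ₁ * v ∧ τ θ = algebraMap k E γ * θ ∧
      σ v = v ∧ σ θ = algebraMap k E ζ₂ * θ ∧
      ∀ g ∈ G, ∃ i j : ℕ, g = τ ^ i * σ ^ j := by
  have := NeZero.mk hp.ne_zero
  have hfix : ∀ g : E ≃ₐ[k] E, g x = x → ∀ a ∈ k⟮x⟯, g a = a := fun g hg a ha ↦
    AlgEquiv.apply_eq_of_mem_adjoin_simple (h := 1) (by simpa using hg) ha
  obtain ⟨σ, hσ, hσx, hσ1⟩ : ∃ σ ∈ G, σ x = x ∧ σ ≠ 1 := by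
    by_contra! hcon
    obtain ⟨τ, hτ, hτ1⟩ : ∃ τ ∈ G, τ ≠ 1 := by
      by_contra! h
      exact hcyc 1 (one_mem G) fun g hg ↦ by simp [h g hg]
    have hτx : τ x ≠ x := fun h ↦ hτ1 (hcon τ hτ h)
    obtain ⟨-, -, -, -, -, hgen⟩ :=
      AlgEquiv.exists_scaled_base_generator hp hodd hζ hx (hGx τ hτ) (hexp τ hτ) hτx
    refine hcyc τ hτ fun g hg ↦ ?_
    obtain ⟨i, hi⟩ := hgen g (hGx g hg) (hexp g hg) (hcomm τ hτ g hg)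
    have h1 : (τ ^ i)⁻¹ * g = 1 := by
      refine hcon _ (mul_mem (inv_mem (pow_mem hτ i)) hg) ?_
      rw [AlgEquiv.mul_apply, hi x (mem_adjoin_simple_self k x), ← AlgEquiv.mul_apply,
        inv_mul_cancel, AlgEquiv.one_apply]
    rw [inv_mul_eq_one] at h1
    exact h1 ▸ Subgroup.npow_mem_zpowers τ i
  obtain ⟨u, ζ₂, hu, hu0, hζ₂, hσu, hgu⟩ :=
    AlgEquiv.exists_scaled_fibre_generator hp hodd hζ hy hxy (hfix σ hσx) (hexp σ hσ) hσ1
  have hker : ∀ g ∈ G, g x = x → ∃ j : ℕ, g = σ ^ j := fun g hg hgx ↦ by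
    obtain ⟨f, hf, hfu⟩ := hgu g (hGx g hg) (hcomm σ hσ g hg)
    have hfp := AlgEquiv.pow_eq_one_of_eq_mul hu0 hfu (hfix g hgx f hf) (hexp g hg)
    obtain ⟨j, -, hj⟩ := (hζ₂.map_of_injective (algebraMap k E).injective).eq_pow_of_pow_eq_one hfp
    refine ⟨j, AlgEquiv.eq_of_adjoin_eq_top hu (fun a ha ↦ ?_) ?_⟩
    · have : (σ ^ j) x = x := by
        simpa using AlgEquiv.pow_apply_of_eq_mul (z := x) (f := 1) (by simpa using hσx) (by simp) j
      rw [hfix g hgx a ha, hfix _ this a ha]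
    · rw [hfu, ← hj, AlgEquiv.pow_apply_of_eq_mul hσu (by simp)]
  obtain ⟨τ, hτ, hτx⟩ : ∃ τ ∈ G, τ x ≠ x := by
    by_contra! hcon
    refine hcyc σ hσ fun g hg ↦ ?_
    obtain ⟨j, rfl⟩ := hker g hg (hcon g hg)
    exact Subgroup.npow_mem_zpowers σ j
  obtain ⟨v, ζ₁, hv, hζ₁, hτv, hgen⟩ :=
    AlgEquiv.exists_scaled_base_generator hp hodd hζ hx (hGx τ hτ) (hexp τ hτ) hτx
  obtain ⟨h, j, hh, hh0, hτh⟩ := AlgEquiv.exists_rescale hp hζ (hGx τ hτ) (hexp τ hτ) hu0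
    (hgu τ (hGx τ hτ) (hcomm σ hσ τ hτ))
  refine ⟨v, h * u, σ, τ, ζ₁, ζ₂, ζ ^ j, hv, ?_, hσ, hτ, hζ₁, hζ₂,
    by rw [pow_right_comm, hζ.pow_eq_one, one_pow], hτv, hτh,
    hfix σ hσx v (hv ▸ mem_adjoin_simple_self k v),
    by rw [map_mul, hσu, hfix σ hσx h hh, mul_left_comm], fun g hg ↦ ?_⟩
  · rw [eq_top_iff, ← hu, adjoin_simple_le_iff]
    have h1 : algebraMap k⟮x⟯ E ⟨h, hh⟩ ∈ k⟮x⟯⟮h * u⟯ := _root_.algebraMap_mem _ _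
    have h2 := div_mem (mem_adjoin_simple_self k⟮x⟯ (h * u)) h1
    have h3 : h * u / algebraMap k⟮x⟯ E ⟨h, hh⟩ = u := mul_div_cancel_left₀ u hh0
    rwa [h3] at h2
  · obtain ⟨i, hi⟩ := hgen g (hGx g hg) (hexp g hg) (hcomm τ hτ g hg)
    obtain ⟨j, hj⟩ := hker ((τ ^ i)⁻¹ * g) (mul_mem (inv_mem (pow_mem hτ i)) hg) (by
      rw [AlgEquiv.mul_apply, hi x (mem_adjoin_simple_self k x), ← AlgEquiv.mul_apply,
        inv_mul_cancel, AlgEquiv.one_apply])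
    exact ⟨i, j, by rw [← hj, mul_inv_cancel_left]⟩

end

theorem algebraicIndependent_pair_iff {F E : Type*} [Field F] [Field E] [Algebra F E]
    {z : Fin 2 → E} :
    AlgebraicIndependent F z ↔ Transcendental F (z 0) ∧ Transcendental F⟮z 0⟯ (z 1) := by
  let : Unique {j : Fin 2 // j ≠ 1} := ⟨⟨⟨0, by decide⟩⟩, fun ⟨j, hj⟩ ↦ by
    fin_cases j
    · rfl
    · exact absurd rfl hj⟩
  have hs : ({1}ᶜ : Set (Fin 2)) = {0} := by ext j; fin_cases j <;> simp
  rw [AlgebraicIndependent.iff_transcendental_adjoin_image 1,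
    algebraicIndependent_unique_type_iff, hs, Set.image_singleton,
    IntermediateField.transcendental_adjoin_iff]
  rfl

theorem algebraicIndependent_Xv (k : Type*) [Field k] : AlgebraicIndependent k (Xv k) :=
  (MvPolynomial.algebraicIndependent_X (Fin 2) k).map'
    (f := IsScalarTower.toAlgHom k (MvPolynomial (Fin 2) k) (Kxy k))
    (IsFractionRing.injective _ _)

theorem adjoin_range_pair {F E : Type*} [Field F] [Field E] [Algebra F E] (z : Fin 2 → E) :
    adjoin F (Set.range z) = F⟮z 0⟯⟮z 1⟯.restrictScalars F := by
  rw [adjoin_simple_adjoin_simple]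
  congr 1
  ext; simp [eq_comm]

theorem adjoin_range_Xv (k : Type*) [Field k] : adjoin k (Set.range (Xv k)) = ⊤ := by
  rw [← IsFractionRing.algHom_fieldRange_eq_of_comp_eq_of_range_eq
    (g := MvPolynomial.aeval (Xv k)) (f := AlgHom.id k (Kxy k))
    (by
      ext c
      · simpa using (IsScalarTower.algebraMap_apply k (MvPolynomial (Fin 2) k) (Kxy k) c).symm
      · simp)
    (Algebra.adjoin_range_eq_range_aeval k (Xv k)).symm]
  exact AlgHom.fieldRange_eq_top.2 Function.surjective_id

theorem exists_algEquiv_Kxy {k E : Type*} [Field k] [Field E] [Algebra k E] {v θ : E}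
    (hv : Transcendental k v) (hθ : Transcendental k⟮v⟯ θ) (hvθ : k⟮v⟯⟮θ⟯ = ⊤) :
    ∃ ψ : Kxy k ≃ₐ[k] E, ψ (Xv k 0) = v ∧ ψ (Xv k 1) = θ := by
  have h : AlgebraicIndependent k ![v, θ] := algebraicIndependent_pair_iff.2 ⟨hv, hθ⟩
  have htop : adjoin k (Set.range ![v, θ]) = ⊤ := by
    rw [adjoin_range_pair]; exact restrictScalars_eq_top_iff.2 hvθ
  refine ⟨(h.aevalEquivField.trans (equivOfEq htop)).trans topEquiv, ?_, ?_⟩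
  · exact (h.aevalEquivField_algebraMap_apply_coe _).trans (by simp)
  · exact (h.aevalEquivField_algebraMap_apply_coe _).trans (by simp)

theorem Subgroup.commute_of_mulEquiv_multiplicative {H A : Type*} [Group H] [AddCommGroup A]
    {G : Subgroup H} (e : G ≃* Multiplicative A) {σ τ : H} (hσ : σ ∈ G) (hτ : τ ∈ G) :
    σ * τ = τ * σ :=
  congrArg Subtype.val (e.injective (by simp only [map_mul, mul_comm]) :
    (⟨σ, hσ⟩ : G) * ⟨τ, hτ⟩ = ⟨τ, hτ⟩ * ⟨σ, hσ⟩)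

theorem Subgroup.pow_eq_one_of_mulEquiv {H : Type*} [Group H] {p n : ℕ} {G : Subgroup H}
    (e : G ≃* Multiplicative (Fin n → ZMod p)) {σ : H} (hσ : σ ∈ G) : σ ^ p = 1 :=
  congrArg Subtype.val (e.injective (by
    rw [map_pow, map_one]
    apply Multiplicative.toAdd.injective
    rw [toAdd_pow, toAdd_one]
    ext; simp) : (⟨σ, hσ⟩ : G) ^ p = 1)

theorem Subgroup.not_le_zpowers_of_mulEquiv {H : Type*} [Group H] {p : ℕ} (hp : p.Prime)
    {G : Subgroup H} (e : G ≃* Multiplicative (Fin 2 → ZMod p)) {σ : H} (hσ : σ ∈ G) :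
    ¬ G ≤ Subgroup.zpowers σ := by
  intro h
  have hσp := pow_eq_one_of_mulEquiv e hσ
  have hfin : IsOfFinOrder σ := isOfFinOrder_iff_pow_eq_one.2 ⟨p, hp.pos, hσp⟩
  have : Finite (Subgroup.zpowers σ) := hfin.finite_zpowers
  have hcard := Subgroup.card_le_of_le h
  rw [Nat.card_congr (e.toEquiv.trans Multiplicative.toAdd), Nat.card_zpowers] at hcard
  have hle := Nat.le_of_dvd hp.pos (orderOf_dvd_of_pow_eq_one hσp)
  rw [Nat.card_fun, Nat.card_zmod, Nat.card_fin] at hcard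
  have := hp.two_le
  nlinarith

theorem IsAlgClosed.exists_isPrimitiveRoot_of_ringChar_ne (k : Type*) [Field k] [IsAlgClosed k]
    {p : ℕ} (hp : p.Prime) (hchar : ringChar k ≠ p) : ∃ ζ : k, IsPrimitiveRoot ζ p := by
  have : NeZero (p : k) := ⟨fun h ↦ by
    rcases (Nat.dvd_prime hp).1 (ringChar.dvd h) with h1 | h1
    · exact CharP.ringChar_ne_one h1
    · exact hchar h1⟩
  exact HasEnoughRootsOfUnity.exists_primitiveRoot k p

end

/-- `k` algebraically closed, `p` an odd prime `≠ char k`, `G ≤ Aut_k(k(x,y))`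
preserving `k(x)` elementwise-as-a-set and isomorphic to `(ℤ/p)²`.  Then `G` is conjugate,
by some `φ` with `φ(k(x)) = k(x)`, to the group of automorphisms `x ↦ βx`, `y ↦ αy`
with `α^p = β^p = 1`. -/
theorem p_elementary_P1_fibration_rank_two_conjugate
    (k : Type*) [Field k] [IsAlgClosed k]
    (p : ℕ) (hp : p.Prime) (hodd : Odd p) (hchar : ringChar k ≠ p)
    (G : Subgroup (Kxy k ≃ₐ[k] Kxy k))
    (hGx : ∀ σ ∈ G, (⇑σ) '' (Kx k : Set (Kxy k)) = (Kx k : Set (Kxy k)))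
    (hG : Nonempty (G ≃* Multiplicative (Fin 2 → ZMod p))) :
    ∃ φ : Kxy k ≃ₐ[k] Kxy k,
      (⇑φ) '' (Kx k : Set (Kxy k)) = (Kx k : Set (Kxy k)) ∧
      ∀ σ : Kxy k ≃ₐ[k] Kxy k,
        σ ∈ Subgroup.map (MulAut.conj φ).toMonoidHom G ↔
        ∃ α β : k, α ^ p = 1 ∧ β ^ p = 1 ∧
          σ (Xv k 0) = algebraMap k (Kxy k) β * Xv k 0 ∧
          σ (Xv k 1) = algebraMap k (Kxy k) α * Xv k 1 := by
  obtain ⟨e⟩ := hG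
  have := NeZero.mk hp.ne_zero
  obtain ⟨ζ, hζ⟩ := IsAlgClosed.exists_isPrimitiveRoot_of_ringChar_ne k hp hchar
  obtain ⟨hx, hy⟩ := algebraicIndependent_pair_iff.1 (algebraicIndependent_Xv k)
  have hxy : IntermediateField.adjoin (Kx k) {Xv k 1} = ⊤ := by
    rw [← IntermediateField.restrictScalars_eq_top_iff (K := k), ← adjoin_range_Xv,
      adjoin_range_pair]
  obtain ⟨v, θ, σ, τ, ζ₁, ζ₂, γ, hv, hθ, hσ, hτ, hζ₁, hζ₂, hγ, hτv, hτθ, hσv, hσθ, hgen⟩ :=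
    exists_simultaneous_diagonalisation hp hodd hζ hx hy hxy G hGx
      (fun _ h _ h' ↦ Subgroup.commute_of_mulEquiv_multiplicative e h h')
      (fun _ h ↦ Subgroup.pow_eq_one_of_mulEquiv e h)
      (fun _ h ↦ Subgroup.not_le_zpowers_of_mulEquiv hp e h)
  have hθtr : Transcendental (Kx k) θ := hy.of_adjoin_eq (hθ.trans hxy.symm)
  obtain ⟨ψ, hψ0, hψ1⟩ := exists_algEquiv_Kxy (hx.of_adjoin_eq hv) (by rwa [hv]) (by rwa [hv])
  have hφv : ψ.symm v = Xv k 0 := by rw [← hψ0, ψ.symm_apply_apply]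
  have hφθ : ψ.symm θ = Xv k 1 := by rw [← hψ1, ψ.symm_apply_apply]
  have hact : ∀ i j : ℕ,
      (τ ^ i * σ ^ j) v = algebraMap k (Kxy k) (ζ₁ ^ i) * v ∧
      (τ ^ i * σ ^ j) θ = algebraMap k (Kxy k) (γ ^ i * ζ₂ ^ j) * θ := fun i j ↦ by
    constructor
    · rw [AlgEquiv.mul_apply, AlgEquiv.pow_apply_of_eq_mul (f := 1) (by rw [one_mul, hσv])
        (map_one σ), one_pow, one_mul, AlgEquiv.pow_apply_of_eq_mul hτv (τ.commutes _), map_pow]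
    · rw [AlgEquiv.mul_apply, AlgEquiv.pow_apply_of_eq_mul hσθ (σ.commutes _), ← map_pow, map_mul,
        AlgEquiv.commutes, AlgEquiv.pow_apply_of_eq_mul hτθ (τ.commutes _), map_mul, map_pow,
        map_pow]
      ring
  have hconj : ∀ i j : ℕ,
      (MulAut.conj ψ.symm (τ ^ i * σ ^ j)) (Xv k 0) = algebraMap k (Kxy k) (ζ₁ ^ i) * Xv k 0 ∧
      (MulAut.conj ψ.symm (τ ^ i * σ ^ j)) (Xv k 1) =
        algebraMap k (Kxy k) (γ ^ i * ζ₂ ^ j) * Xv k 1 := fun i j ↦ by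
    have h : ∀ a, (MulAut.conj ψ.symm (τ ^ i * σ ^ j)) a = ψ.symm ((τ ^ i * σ ^ j) (ψ a)) :=
      fun a ↦ rfl
    rw [h, h, hψ0, hψ1, (hact i j).1, (hact i j).2, map_mul ψ.symm, map_mul ψ.symm, hφv, hφθ,
      AlgEquiv.commutes, AlgEquiv.commutes]
    exact ⟨rfl, rfl⟩
  refine ⟨ψ.symm, ?_, fun s ↦ ⟨?_, ?_⟩⟩
  · have h := IntermediateField.adjoin_map k {v} (ψ.symm : Kxy k →ₐ[k] Kxy k)
    rw [Set.image_singleton, hv] at h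
    exact (congrArg SetLike.coe h).trans (by
      change (IntermediateField.adjoin k {ψ.symm v} : Set (Kxy k)) = _
      rw [hφv])
  · rintro ⟨g, hg, rfl⟩
    obtain ⟨i, j, rfl⟩ := hgen g hg
    refine ⟨γ ^ i * ζ₂ ^ j, ζ₁ ^ i, ?_, ?_, hconj i j⟩
    · rw [mul_pow, pow_right_comm, hγ, pow_right_comm, hζ₂.pow_eq_one, one_pow, one_pow, one_mul]
    · rw [pow_right_comm, hζ₁.pow_eq_one, one_pow]
  · rintro ⟨α, β, hα, hβ, hs0, hs1⟩
    obtain ⟨i, -, rfl⟩ := hζ₁.eq_pow_of_pow_eq_one hβ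
    have hγi : γ ^ i ≠ 0 := pow_ne_zero _ fun h ↦ by simp [h, hp.ne_zero] at hγ
    obtain ⟨j, -, hj⟩ := hζ₂.eq_pow_of_pow_eq_one (ξ := α / γ ^ i)
      (by rw [div_pow, hα, pow_right_comm, hγ, one_pow, div_one])
    rw [eq_div_iff hγi, mul_comm] at hj
    obtain ⟨h0, h1⟩ := hconj i j
    refine ⟨τ ^ i * σ ^ j, mul_mem (pow_mem hτ i) (pow_mem hσ j), ?_⟩
    refine AlgEquiv.eq_of_adjoin_eq_top hxy
      (fun a ha ↦ AlgEquiv.apply_eq_of_mem_adjoin_simple (h0.trans hs0.symm) ha) ?_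
    exact h1.trans (by rw [hs1, hj])
end

section
/- Let k be an algebraically closed field, n a positive integer, and p a prime with p ≠ char(k) and p not dividing n. If G is a subgroup of PGL_n(k) isomorphic to (ℤ/p)^{n−1}, then G is conjugate in PGL_n(k) to the p-torsion subgroup of the diagonal torus, i.e. to the subgroup consisting of the classes of all diagonal matrices whose diagonal entries are p-th roots of unity in k. -/
/-- `PGL_n(k)`: the quotient of `GL_n(k)` by its center. -/
abbrev PGL (n : ℕ) (K : Type*) [Field K] :=
  Matrix.GeneralLinearGroup (Fin n) K ⧸ Subgroup.center (Matrix.GeneralLinearGroup (Fin n) K)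

open Matrix Module in
/-- A commuting family of invertible matrices, all killed by an exponent `p` that is nonzero in the
algebraically closed base field, is simultaneously diagonalizable, with eigenvalues `p`-th roots
of unity. -/
theorem Matrix.GeneralLinearGroup.exists_conj_eq_diagonal_of_commute
    {k : Type*} [Field k] [IsAlgClosed k] {n p : ℕ} (hp : (p : k) ≠ 0) {ι : Type*}
    (A : ι → GL (Fin n) k) (hcomm : ∀ i j, Commute (A i) (A j)) (hpow : ∀ i, A i ^ p = 1) :
    ∃ P : GL (Fin n) k, ∀ i, ∃ d : Fin n → k, (∀ j, d j ^ p = 1) ∧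
      ((P * A i * P⁻¹ : GL (Fin n) k) : Matrix (Fin n) (Fin n) k) = diagonal d := by
  let f : ι → End k (Fin n → k) := fun i ↦ Matrix.toLinAlgEquiv' (A i).val
  have hfpow (i) : f i ^ p = 1 := by
    rw [← map_pow, ← Units.val_pow_eq_pow_val, hpow, Units.val_one, map_one]
  have hss (i) : (f i).IsSemisimple := by
    refine End.isSemisimple_of_squarefree_aeval_eq_zero
      (Polynomial.X_pow_sub_one_separable_iff.2 hp).squarefree ?_
    simp [hfpow]
  have htop : ⨆ χ : ι → k, ⨅ i, (f i).eigenspace (χ i) = ⊤ := by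
    have := End.iSup_iInf_maxGenEigenspace_eq_top_of_iSup_maxGenEigenspace_eq_top_of_commute f
      (fun i j _ ↦ by
        have := congrArg Units.val (hcomm i j).eq
        simp only [Units.val_mul] at this
        simp only [f, Commute, SemiconjBy, ← map_mul, this])
      (fun i ↦ End.iSup_maxGenEigenspace_eq_top (f i))
    simpa only [(End.isFinitelySemisimple_iff_isSemisimple.2
      (hss _)).maxGenEigenspace_eq_eigenspace] using this
  have hspan : ⊤ ≤ Submodule.span k
      (⋃ χ : ι → k, ((⨅ i, (f i).eigenspace (χ i) : Submodule k (Fin n → k)) :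
        Set (Fin n → k))) := by
    rw [← Submodule.iSup_eq_span, htop]
  let b₀ := Basis.ofSpan hspan
  have := FiniteDimensional.fintypeBasisIndex b₀
  let b := b₀.reindex (Fintype.equivFinOfCardEq
    ((finrank_eq_card_basis b₀).symm.trans (finrank_fin_fun k)))
  have hb (j) : ∃ χ : ι → k, ∀ i, f i (b j) = χ i • b j := by
    have hmem : b j ∈ _ := Basis.ofSpan_subset hspan (by
      rw [Basis.reindex_apply]; exact Set.mem_range_self _)
    obtain ⟨χ, hχ⟩ := Set.mem_iUnion.1 hmem
    exact ⟨χ, fun i ↦ End.mem_eigenspace_iff.1 ((Submodule.mem_iInf _).1 hχ i)⟩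
  choose χ hχ using hb
  have hunit : IsUnit (Matrix.of fun i j ↦ b j i) :=
    linearIndependent_cols_iff_isUnit.1 b.linearIndependent
  obtain ⟨Q, hQ⟩ := hunit
  refine ⟨Q⁻¹, fun i ↦ ⟨fun j ↦ χ j i, fun j ↦ ?_, ?_⟩⟩
  · have h (m : ℕ) : (f i ^ m) (b j) = χ j i ^ m • b j := by
      induction m with
      | zero => simp
      | succ m ih => rw [pow_succ', End.mul_apply, ih, map_smul, hχ, smul_smul, pow_succ]
    have h1 := h p
    rw [hfpow, End.one_apply] at h1
    exact (smul_left_injective k (b.ne_zero j) (by simpa using h1)).symm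
  · have key : (A i).val * Q.val = Q.val * diagonal (fun j ↦ χ j i) := by
      ext r j
      have := congrFun (hχ j i) r
      rw [mul_diagonal, hQ]
      simpa [f, mul_apply, mulVec, dotProduct, mul_comm] using this
    rw [inv_inv, mul_assoc, Units.val_mul, Units.val_mul, key, ← mul_assoc, Units.inv_mul, one_mul]

/-- Over an algebraically closed field, an element of `PGL_n` killed by `p` lifts to an element of
`GL_n` killed by `p`. -/
theorem PGL.exists_lift_pow_eq_one {k : Type*} [Field k] [IsAlgClosed k] {n p : ℕ} (hp : 0 < p)
    (g : PGL n k) (hg : g ^ p = 1) :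
    ∃ A : Matrix.GeneralLinearGroup (Fin n) k, QuotientGroup.mk A = g ∧ A ^ p = 1 := by
  obtain ⟨A, rfl⟩ := QuotientGroup.mk_surjective g
  rw [← QuotientGroup.mk_pow, QuotientGroup.eq_one_iff,
    Matrix.GeneralLinearGroup.center_eq_range_scalar] at hg
  obtain ⟨c, hc⟩ := hg
  obtain ⟨b, hb⟩ := IsAlgClosed.exists_pow_nat_eq (c : k) hp
  have hb0 : b ≠ 0 := by
    rintro rfl
    rw [zero_pow hp.ne'] at hb
    exact c.ne_zero hb.symm
  have hbc : Units.mk0 b hb0 ^ p = c := Units.ext (by simpa using hb)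
  have hmem (u : kˣ) : Matrix.GeneralLinearGroup.scalar (Fin n) u ∈
      Subgroup.center (Matrix.GeneralLinearGroup (Fin n) k) := by
    rw [Matrix.GeneralLinearGroup.center_eq_range_scalar]
    exact ⟨u, rfl⟩
  refine ⟨A * Matrix.GeneralLinearGroup.scalar (Fin n) (Units.mk0 b hb0)⁻¹, ?_, ?_⟩
  · rw [QuotientGroup.mk_mul, (QuotientGroup.eq_one_iff _).2 (hmem _), mul_one]
  · have hcomm : Commute A (Matrix.GeneralLinearGroup.scalar (Fin n) (Units.mk0 b hb0)⁻¹) :=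
      Subgroup.mem_center_iff.1 (hmem _) A
    rw [hcomm.mul_pow, ← map_pow, inv_pow, hbc, ← hc, ← map_mul, mul_inv_cancel, map_one]

/-- If `p` is coprime to `n`, two elements of `GL_n` killed by `p` commute as soon as
their classes in `PGL_n` do. -/
theorem PGL.commute_of_commute_mk {k : Type*} [Field k] {n p : ℕ} (hpn : p.Coprime n)
    {A B : Matrix.GeneralLinearGroup (Fin n) k} (hB : B ^ p = 1)
    (h : Commute (QuotientGroup.mk A : PGL n k) (QuotientGroup.mk B)) : Commute A B := by
  have hmem : A * B * A⁻¹ * B⁻¹ ∈ Subgroup.center (Matrix.GeneralLinearGroup (Fin n) k) := by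
    rw [← QuotientGroup.eq_one_iff]
    simp only [QuotientGroup.mk_mul, QuotientGroup.mk_inv]
    rw [h.eq]
    group
  have hcomm := Subgroup.mem_center_iff.1 hmem B
  rw [Matrix.GeneralLinearGroup.center_eq_range_scalar] at hmem
  obtain ⟨w, hw⟩ := hmem
  rw [← hw] at hcomm
  have hconj : A * B * A⁻¹ = Matrix.GeneralLinearGroup.scalar (Fin n) w * B := by
    rw [hw]; group
  have hwp : Matrix.GeneralLinearGroup.scalar (Fin n) (w ^ p) = 1 := by
    have := congrArg (· ^ p) hconj
    simp only [conj_pow, (show Commute _ _ from hcomm.symm).mul_pow, hB] at this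
    simpa using this.symm
  have hwn : w ^ n = 1 := by
    have := congrArg Matrix.GeneralLinearGroup.det hw
    simp only [map_mul, map_inv] at this
    rw [mul_comm (Matrix.GeneralLinearGroup.det A), mul_inv_cancel_right, mul_inv_cancel] at this
    ext
    simpa [Units.ext_iff] using this
  have hw1 : Matrix.GeneralLinearGroup.scalar (Fin n) w = 1 := by
    refine orderOf_eq_one_iff.1 (Nat.eq_one_of_dvd_coprimes hpn ?_ ?_)
    · rw [orderOf_dvd_iff_pow_eq_one, ← map_pow, hwp]
    · rw [orderOf_dvd_iff_pow_eq_one, ← map_pow, hwn, map_one]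
  rw [hw1, one_mul] at hconj
  exact mul_inv_eq_iff_eq_mul.1 hconj

/-- The classes in `PGL_n(k)` of the diagonal matrices whose entries are `p`-th roots of unity. -/
def PGL.diagonalTorsion (n : ℕ) (k : Type*) [Field k] (p : ℕ) : Set (PGL n k) :=
  {g | ∃ d : Fin n → k, (∀ i, d i ^ p = 1) ∧ ∃ M : Matrix.GeneralLinearGroup (Fin n) k,
    (M : Matrix (Fin n) (Fin n) k) = Matrix.diagonal d ∧ g = QuotientGroup.mk M}

theorem PGL.diagonalTorsion_finite_and_ncard_le {k : Type*} [Field k] {n p : ℕ} (hn : 0 < n)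
    (hp : 0 < p) :
    (PGL.diagonalTorsion n k p).Finite ∧ (PGL.diagonalTorsion n k p).ncard ≤ p ^ (n - 1) := by
  obtain ⟨m, rfl⟩ := Nat.exists_eq_succ_of_ne_zero hn.ne'
  have : NeZero p := ⟨hp.ne'⟩
  let F : (Fin m → rootsOfUnity p k) → PGL (m + 1) k := fun e ↦
    QuotientGroup.mk (Units.map (Matrix.diagonalRingHom (Fin (m + 1)) k).toMonoidHom
      (MulEquiv.piUnits.symm (Fin.cons 1 fun i ↦ (e i : kˣ))))
  have hsub : PGL.diagonalTorsion (m + 1) k p ⊆ Set.range F := by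
    rintro _ ⟨d, hd, M, hM, rfl⟩
    have hd0 (i) : d i ≠ 0 := fun h ↦ by simpa [h, hp.ne'] using hd i
    refine ⟨fun i ↦ ⟨Units.mk0 (d i.succ / d 0) (div_ne_zero (hd0 _) (hd0 _)), ?_⟩, ?_⟩
    · rw [mem_rootsOfUnity]
      ext
      simp [div_pow, hd]
    · refine QuotientGroup.eq.2 ?_
      rw [Matrix.GeneralLinearGroup.center_eq_range_scalar]
      refine ⟨Units.mk0 (d 0) (hd0 0), ?_⟩
      rw [eq_inv_mul_iff_mul_eq]
      ext i j
      refine Fin.cases ?_ (fun i ↦ ?_) i <;>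
        simp [hM, Matrix.diagonal_apply, MulEquiv.piUnits, hd0]
  have hcard : (Set.range F).ncard ≤ p ^ m := by
    calc (Set.range F).ncard ≤ Nat.card (Fin m → rootsOfUnity p k) := by
          rw [← Set.image_univ, ← Set.ncard_univ]
          exact Set.ncard_image_le
      _ = Nat.card (rootsOfUnity p k) ^ m := by simp [Nat.card_pi]
      _ ≤ p ^ m := Nat.pow_le_pow_left (card_rootsOfUnity k p) m
  exact ⟨(Set.finite_range F).subset hsub,
    (Set.ncard_le_ncard hsub (Set.finite_range F)).trans hcard⟩

/-- `k` algebraically closed, `n ≥ 1`, `p` a prime with `p ≠ char k` and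
`p ∤ n`.  If `G ≤ PGL_n(k)` is isomorphic to `(ℤ/p)^{n-1}` then `G` is conjugate to the
`p`-torsion subgroup of the diagonal torus, i.e. the classes of diagonal matrices whose
entries are `p`-th roots of unity. -/
theorem p_elementary_PGLn_max_rank_conjugate_to_diagonal
    (k : Type*) [Field k] [IsAlgClosed k]
    (n : ℕ) (hn : 0 < n)
    (p : ℕ) (hp : p.Prime) (hchar : ringChar k ≠ p) (hpn : ¬ p ∣ n)
    (G : Subgroup (PGL n k))
    (hG : Nonempty (G ≃* Multiplicative (Fin (n - 1) → ZMod p))) :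
    ∃ φ : PGL n k,
      ∀ g : PGL n k,
        g ∈ Subgroup.map (MulAut.conj φ).toMonoidHom G ↔
        ∃ d : Fin n → k, (∀ i, d i ^ p = 1) ∧
          ∃ M : Matrix.GeneralLinearGroup (Fin n) k,
            (M : Matrix (Fin n) (Fin n) k) = Matrix.diagonal d ∧
            g = QuotientGroup.mk M := by
  obtain ⟨e⟩ := hG
  have hpk : (p : k) ≠ 0 := fun h ↦ by
    rcases (Nat.dvd_prime hp).1 (ringChar.dvd h) with h1 | h1
    · exact CharP.ringChar_ne_one h1
    · exact hchar h1
  have hexp (g : G) : g ^ p = 1 := e.injective (by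
    rw [map_pow, map_one]
    apply Multiplicative.toAdd.injective
    ext i
    simp)
  have hcomm (g h : G) : Commute g h := e.injective (by rw [map_mul, map_mul, mul_comm])
  have hlift (g : G) := PGL.exists_lift_pow_eq_one hp.pos (g : PGL n k)
    (by exact_mod_cast congrArg Subtype.val (hexp g))
  choose A hAmk hApow using hlift
  have hA (g h : G) : Commute (A g) (A h) :=
    PGL.commute_of_commute_mk ((Nat.Prime.coprime_iff_not_dvd hp).2 hpn) (hApow h) (by
      rw [hAmk, hAmk]
      exact congrArg Subtype.val (hcomm g h).eq)
  obtain ⟨P, hP⟩ :=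
    Matrix.GeneralLinearGroup.exists_conj_eq_diagonal_of_commute hpk A hA hApow
  refine ⟨QuotientGroup.mk P, fun g ↦ ?_⟩
  set H := Subgroup.map (MulAut.conj (QuotientGroup.mk P : PGL n k)).toMonoidHom G
  have hsub : (H : Set (PGL n k)) ⊆ PGL.diagonalTorsion n k p := by
    rintro _ ⟨g, hg, rfl⟩
    obtain ⟨d, hd, hPd⟩ := hP ⟨g, hg⟩
    refine ⟨d, hd, _, hPd, ?_⟩
    simp [hAmk]
  have hcard : (H : Set (PGL n k)).ncard = p ^ (n - 1) := by
    have := Fact.mk hp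
    rw [← Nat.card_coe_set_eq]
    calc Nat.card H = Nat.card G :=
          (Nat.card_congr (G.equivMapOfInjective _ (MulAut.conj _).injective).toEquiv).symm
      _ = Nat.card (Fin (n - 1) → ZMod p) := Nat.card_congr (e.toEquiv.trans Multiplicative.toAdd)
      _ = p ^ (n - 1) := by simp
  obtain ⟨hfin, hle⟩ := PGL.diagonalTorsion_finite_and_ncard_le (k := k) hn hp.pos
  have heq := Set.eq_of_subset_of_ncard_le hsub (hle.trans hcard.ge) hfin
  exact Set.ext_iff.1 heq g
end
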